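/- Grant Assumption 1 and let d > 1. Then for every x_c ∈ 𝒳 and every z ∈ ℝ^d with z ≠ x_c, the conditional density of the SMOTE-generated point satisfies the far-point bound f_{Z_{K,n}}(z | X_c = x_c) ≤ C₂·((n−1)/K)·(2R)^{d−1}/((d−1)·‖z−x_c‖^{d−1}). -/

import Mathlib

open MeasureTheory

noncomputable section

/-- The incomplete beta function `𝓑(a,b;x) = ∫₀ˣ t^(a-1) (1-t)^(b-1) dt`. -/
def incBeta (a b x : ℝ) : ℝ :=
  ∫ t in (0:ℝ)..x, t ^ (a - 1) * (1 - t) ^ (b - 1)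

/-- The conditional density of the SMOTE-generated point `Z_{K,n}` given that the central
point is `x_c` (Lemma 2):
`f_{Z_{K,n}}(z | X_c = x_c) = (n-K-1) C(n-1,K) ∫₀¹ w^{-d} f(x_c + (z-x_c)/w)
  𝓑(n-K-1, K; 1 - μ_X(B(x_c, ‖z-x_c‖/w))) dw`. -/
def smoteCondDensity (d n K : ℕ) (f : EuclideanSpace ℝ (Fin d) → ℝ)
    (xc z : EuclideanSpace ℝ (Fin d)) : ℝ :=
  ((n:ℝ) - K - 1) * ((n - 1).choose K) *
    ∫ w in (0:ℝ)..1, (1 / w ^ d) * f (xc + w⁻¹ • (z - xc)) *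
      incBeta ((n:ℝ) - K - 1) (K:ℝ) (1 - ∫ y in Metric.ball xc (‖z - xc‖ / w), f y)

/-- The incomplete beta function is nonnegative on the unit interval. -/
lemma incBeta_nonneg {a b x : ℝ} (hx0 : 0 ≤ x) (hx1 : x ≤ 1) : 0 ≤ incBeta a b x := by
  refine intervalIntegral.integral_nonneg hx0 fun t ht => ?_
  have := ht.1
  have : 0 ≤ 1 - t := by linarith [ht.2]
  positivity

/-- The incomplete beta function at `1` is the complete beta function. -/
lemma incBeta_one_eq_beta {a b : ℝ} (ha : 0 < a) (hb : 0 < b) :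
    incBeta a b 1 = ProbabilityTheory.beta a b := by
  rw [ProbabilityTheory.beta_eq_betaIntegralReal a b ha hb, ← Complex.ofReal_re (incBeta a b 1),
    incBeta, ← intervalIntegral.integral_ofReal, Complex.betaIntegral]
  congr 1
  refine intervalIntegral.integral_congr fun t ht => ?_
  rw [Set.uIcc_of_le zero_le_one] at ht
  have : 0 ≤ 1 - t := by linarith [ht.2]
  simp only [Complex.ofReal_mul]
  rw [Complex.ofReal_cpow ht.1, Complex.ofReal_cpow this]
  push_cast
  rfl

/-- The incomplete beta function is at most the complete beta function. -/
lemma incBeta_le_beta {a b x : ℝ} (ha : 0 < a) (hb : 0 < b) (hx0 : 0 ≤ x) (hx1 : x ≤ 1) :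
    incBeta a b x ≤ ProbabilityTheory.beta a b := by
  rw [← incBeta_one_eq_beta ha hb]
  have hint : IntervalIntegrable (fun t : ℝ => t ^ (a - 1) * (1 - t) ^ (b - 1)) volume 0 1 := by
    by_contra h
    have h0 : incBeta a b 1 = 0 := intervalIntegral.integral_undef h
    rw [incBeta_one_eq_beta ha hb] at h0
    exact (ProbabilityTheory.beta_pos ha hb).ne' h0
  refine intervalIntegral.integral_mono_interval le_rfl hx0 hx1 ?_ hint
  filter_upwards [ae_restrict_mem measurableSet_Ioc] with t ht
  have := ht.1
  have : 0 ≤ 1 - t := by linarith [ht.2]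
  simp only [Pi.zero_apply]
  positivity

/-- The binomial prefactor times the complete beta function at natural arguments. -/
lemma choose_mul_beta {N K : ℕ} (hN : 1 ≤ N) (hK : 1 ≤ K) :
    (N : ℝ) * ((N + K).choose K) * ProbabilityTheory.beta N K = ((N : ℝ) + K) / K := by
  obtain ⟨N, rfl⟩ := Nat.exists_eq_add_of_le' hN
  obtain ⟨K, rfl⟩ := Nat.exists_eq_add_of_le' hK
  have hc := Nat.add_choose_mul_factorial_mul_factorial (N + 1) (K + 1)
  have hc' : (((N + 1 + (K + 1)).choose (K + 1) : ℕ) : ℝ) * ((N + 1) * N.factorial)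
      * ((K + 1) * K.factorial) = (N + 1 + K + 1) * (N + 1 + K).factorial := by
    rw [Nat.factorial_succ N, Nat.factorial_succ K,
      ← add_assoc, Nat.factorial_succ (N + 1 + K)] at hc
    exact_mod_cast hc
  have hG : Real.Gamma (((N + 1 : ℕ) : ℝ) + ((K + 1 : ℕ) : ℝ)) = (N + 1 + K).factorial := by
    rw [← Real.Gamma_nat_eq_factorial]
    push_cast
    ring_nf
  rw [ProbabilityTheory.beta, hG]
  push_cast
  rw [Real.Gamma_nat_eq_factorial, Real.Gamma_nat_eq_factorial]
  have := Nat.factorial_pos (N + 1 + K)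
  field_simp
  linarith

/-- The function `w ↦ w⁻ᵈ` is integrable at infinity for `d > 1`. -/
lemma integrableOn_Ioi_one_div_pow {d : ℕ} (hd : 1 < d) {c : ℝ} (hc : 0 < c) :
    IntegrableOn (fun w : ℝ => 1 / w ^ d) (Set.Ioi c) := by
  have hd' : (1 : ℝ) < d := by exact_mod_cast hd
  refine (integrableOn_Ioi_rpow_of_lt (show -(d : ℝ) < -1 by linarith) hc).congr_fun
    (fun w hw => ?_) measurableSet_Ioi
  have : 0 < w := hc.trans hw
  simp [Real.rpow_neg this.le]

/-- The tail integral of `w⁻ᵈ` beyond the ratio `r / s`. -/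
lemma integral_Ioi_one_div_pow {d : ℕ} (hd : 1 < d) {s r : ℝ} (hs : 0 < s) (hr : 0 < r) :
    ∫ w in Set.Ioi (r / s), 1 / w ^ d = s ^ (d - 1) / (((d : ℝ) - 1) * r ^ (d - 1)) := by
  have hd' : (1 : ℝ) < d := by exact_mod_cast hd
  have hc : 0 < r / s := by positivity
  have hcongr : ∫ w in Set.Ioi (r / s), 1 / w ^ d = ∫ w in Set.Ioi (r / s), w ^ (-(d : ℝ)) := by
    refine setIntegral_congr_fun measurableSet_Ioi fun w hw => ?_
    have : 0 < w := hc.trans hw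
    simp [Real.rpow_neg this.le]
  have hexp : -(d : ℝ) + 1 = -((d - 1 : ℕ) : ℝ) := by
    rw [Nat.cast_sub hd.le, Nat.cast_one]
    ring
  rw [hcongr, integral_Ioi_rpow_of_lt (by linarith) hc, hexp, Real.rpow_neg hc.le,
    Real.rpow_natCast, div_pow, Nat.cast_sub hd.le, Nat.cast_one]
  have : (d : ℝ) - 1 ≠ 0 := by linarith
  field_simp

/-- **Far-point bound for the conditional SMOTE density.**  Under Assumption 1 and for
`d > 1`, for every central point `x_c ∈ 𝒳` and every `z ≠ x_c`, the conditional density of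
the SMOTE-generated point `Z_{K,n}` given `X_c = x_c` satisfies
`f_{Z_{K,n}}(z | X_c = x_c) ≤ C₂ ((n-1)/K) (2R)^{d-1} / ((d-1) ‖z-x_c‖^{d-1})`. -/
theorem smote_conditional_density_far_bound
    (d n K : ℕ) (hd : 1 < d) (hK1 : 1 ≤ K) (hKn : K ≤ n - 1)
    (f : EuclideanSpace ℝ (Fin d) → ℝ)
    (hf_meas : Measurable f) (hf_nonneg : ∀ x, 0 ≤ f x) (hf_int : ∫ x, f x = 1)
    -- Assumption 1
    (R C₁ C₂ : ℝ) (hR : 0 < R) (hC₁ : 0 < C₁) (hC₁₂ : C₁ < C₂)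
    (hsupp : Function.support f ⊆ Metric.ball (0 : EuclideanSpace ℝ (Fin d)) R)
    (hf_low : ∀ x, (Function.support f).indicator (fun _ => C₁) x ≤ f x)
    (hf_up : ∀ x, f x ≤ (Function.support f).indicator (fun _ => C₂) x)
    (xc : EuclideanSpace ℝ (Fin d)) (hxc : xc ∈ Function.support f)
    (z : EuclideanSpace ℝ (Fin d)) (hz : z ≠ xc) :
    smoteCondDensity d n K f xc z
      ≤ C₂ * (((n:ℝ) - 1) / K) * (2 * R) ^ (d - 1) / (((d:ℝ) - 1) * ‖z - xc‖ ^ (d - 1)) := by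
  have hC₂ : 0 < C₂ := hC₁.trans hC₁₂
  have hr : 0 < ‖z - xc‖ := norm_pos_iff.2 (sub_ne_zero.2 hz)
  have hd' : (0 : ℝ) < d - 1 := by
    have : (1 : ℝ) < d := by exact_mod_cast hd
    linarith
  have hKpos : (0 : ℝ) < K := by exact_mod_cast hK1
  obtain ⟨N, hN⟩ : ∃ N, n = N + K + 1 := ⟨n - 1 - K, by omega⟩
  subst hN
  have hcast : ((N + K + 1 : ℕ) : ℝ) - K - 1 = N := by push_cast; ring
  have hcast' : ((N + K + 1 : ℕ) : ℝ) - 1 = N + K := by push_cast; ring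
  rw [smoteCondDensity, hcast, hcast', Nat.add_sub_cancel]
  rcases Nat.eq_zero_or_pos N with rfl | hNpos
  · simp only [Nat.cast_zero, zero_mul]
    positivity
  have hNpos' : (0 : ℝ) < N := by exact_mod_cast hNpos
  set β := ProbabilityTheory.beta N K with hβ
  have hβpos : 0 < β := ProbabilityTheory.beta_pos hNpos' hKpos
  have hf_integrable : Integrable f := by
    by_contra h
    rw [integral_undef h] at hf_int
    exact zero_ne_one hf_int
  have hball (s : Set (EuclideanSpace ℝ (Fin d))) :
      0 ≤ 1 - ∫ y in s, f y ∧ 1 - ∫ y in s, f y ≤ 1 := by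
    have h1 : ∫ y in s, f y ≤ 1 :=
      hf_int ▸ setIntegral_le_integral hf_integrable (.of_forall hf_nonneg)
    have h2 : 0 ≤ ∫ y in s, f y := integral_nonneg hf_nonneg
    constructor <;> linarith
  have key : ∫ w in (0:ℝ)..1, (1 / w ^ d) * f (xc + w⁻¹ • (z - xc)) *
      incBeta N K (1 - ∫ y in Metric.ball xc (‖z - xc‖ / w), f y)
      ≤ C₂ * β * ((2 * R) ^ (d - 1) / ((d - 1) * ‖z - xc‖ ^ (d - 1))) := by
    rw [← integral_Ioi_one_div_pow hd (show 0 < 2 * R by positivity) hr,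
      intervalIntegral.integral_of_le zero_le_one, ← integral_const_mul]
    have hint : Integrable (fun w : ℝ => (Set.Ioi (‖z - xc‖ / (2 * R))).indicator
        (fun w => C₂ * β * (1 / w ^ d)) w) :=
      (integrable_indicator_iff measurableSet_Ioi).2
        ((integrableOn_Ioi_one_div_pow hd (by positivity)).const_mul _)
    have hnn (w : ℝ) : 0 ≤ (Set.Ioi (‖z - xc‖ / (2 * R))).indicator
        (fun w => C₂ * β * (1 / w ^ d)) w := by
      refine Set.indicator_nonneg (fun w hw => ?_) w
      have : 0 < w := lt_trans (by positivity) hw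
      positivity
    rw [← integral_indicator measurableSet_Ioi]
    refine le_trans ?_ (setIntegral_le_integral (s := Set.Ioc 0 1) hint (.of_forall hnn))
    refine integral_mono_of_nonneg ?_ hint.integrableOn ?_
    · filter_upwards [ae_restrict_mem measurableSet_Ioc] with w hw
      have hw0 := hw.1
      have := incBeta_nonneg (a := N) (b := K) (hball (Metric.ball xc (‖z - xc‖ / w))).1
        (hball _).2
      have := hf_nonneg (xc + w⁻¹ • (z - xc))
      simp only [Pi.zero_apply]
      positivity
    · filter_upwards [ae_restrict_mem measurableSet_Ioc] with w hw
      have hw0 := hw.1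
      by_cases hs : xc + w⁻¹ • (z - xc) ∈ Function.support f
      · have hwa : w ∈ Set.Ioi (‖z - xc‖ / (2 * R)) := by
          have h1 := hsupp hs
          have h2 := hsupp hxc
          rw [mem_ball_zero_iff] at h1 h2
          have h3 : ‖w⁻¹ • (z - xc)‖ < 2 * R := by
            calc ‖w⁻¹ • (z - xc)‖ = ‖(xc + w⁻¹ • (z - xc)) - xc‖ := by rw [add_sub_cancel_left]
              _ ≤ ‖xc + w⁻¹ • (z - xc)‖ + ‖xc‖ := norm_sub_le _ _
              _ < 2 * R := by linarith
          rw [norm_smul, norm_inv, Real.norm_of_nonneg hw0.le, inv_mul_lt_iff₀ hw0] at h3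
          rwa [Set.mem_Ioi, div_lt_iff₀ (by positivity)]
        rw [Set.indicator_of_mem hwa]
        have hfu := hf_up (xc + w⁻¹ • (z - xc))
        rw [Set.indicator_of_mem hs] at hfu
        have hB := incBeta_le_beta hNpos' hKpos (hball (Metric.ball xc (‖z - xc‖ / w))).1
          (hball _).2
        have hB0 := incBeta_nonneg (a := N) (b := K)
          (hball (Metric.ball xc (‖z - xc‖ / w))).1 (hball _).2
        calc _ ≤ (1 / w ^ d) * C₂ * β := by gcongr
          _ = _ := by ring
      · rw [Function.notMem_support.1 hs, mul_zero, zero_mul]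
        exact hnn w
  calc _ ≤ (N : ℝ) * ((N + K).choose K) *
        (C₂ * β * ((2 * R) ^ (d - 1) / ((d - 1) * ‖z - xc‖ ^ (d - 1)))) := by gcongr
    _ = C₂ * ((N : ℝ) * ((N + K).choose K) * β) *
        (2 * R) ^ (d - 1) / ((d - 1) * ‖z - xc‖ ^ (d - 1)) := by ring
    _ = _ := by rw [choose_mul_beta hNpos hK1]

end
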